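/- arXiv:1812.09876 — 6 statements merged into one kernel-verified Lean document; each statement's English description precedes it below -/
import Mathlib

section
/- For all real numbers c₁, c₂, c₃, the partial transpose τ^{T_B} of the Bell-diagonal matrix τ is positive semidefinite if and only if λ_ab ≤ 1/2 for all a,b ∈ {0,1}. (In particular, a Bell-diagonal two-qubit state is unentangled precisely when its largest eigenvalue is at most 1/2.) -/
open Matrix
open scoped Matrix Kronecker ComplexOrder

/-- The three Pauli matrices σx, σy, σz. -/
noncomputable def pauli : Fin 3 → Matrix (Fin 2) (Fin 2) ℂ
  | 0 => !![0, 1; 1, 0]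
  | 1 => !![0, -Complex.I; Complex.I, 0]
  | 2 => !![1, 0; 0, -1]

/-- The Bell-diagonal matrix τ = (1/4)(I⊗I + c₁ σ₁⊗σ₁ + c₂ σ₂⊗σ₂ + c₃ σ₃⊗σ₃). -/
noncomputable def bellDiag (c₁ c₂ c₃ : ℝ) : Matrix (Fin 2 × Fin 2) (Fin 2 × Fin 2) ℂ :=
  (1 / 4 : ℂ) • ((1 : Matrix (Fin 2) (Fin 2) ℂ) ⊗ₖ (1 : Matrix (Fin 2) (Fin 2) ℂ)
    + (c₁ : ℂ) • (pauli 0 ⊗ₖ pauli 0)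
    + (c₂ : ℂ) • (pauli 1 ⊗ₖ pauli 1)
    + (c₃ : ℂ) • (pauli 2 ⊗ₖ pauli 2))

/-- The Bell state |β_ab⟩ = (|0,b⟩ + (−1)^a |1,1⊕b⟩)/√2 as a vector in ℂ²⊗ℂ². -/
noncomputable def bellVec (a b : Fin 2) : Fin 2 × Fin 2 → ℂ := fun p =>
  ((if p = (0, b) then 1 else 0)
    + (-1 : ℂ) ^ (a : ℕ) * (if p = (1, b + 1) then 1 else 0)) / (Real.sqrt 2 : ℂ)

/-- The rank-one projector β_ab = |β_ab⟩⟨β_ab|. -/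
noncomputable def bellProj (a b : Fin 2) : Matrix (Fin 2 × Fin 2) (Fin 2 × Fin 2) ℂ :=
  Matrix.vecMulVec (bellVec a b) (star (bellVec a b))

/-- The eigenvalues λ_ab of the Bell-diagonal state. -/
noncomputable def lamBD (c₁ c₂ c₃ : ℝ) (a b : Fin 2) : ℝ :=
  (1 + (-1 : ℝ) ^ (a : ℕ) * c₁ - (-1 : ℝ) ^ ((a : ℕ) + (b : ℕ)) * c₂
    + (-1 : ℝ) ^ (b : ℕ) * c₃) / 4

/-- Projective measurement operators M_a(A) = (I + (−1)^a A)/2 for a ±1-valued observable A. -/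
noncomputable def Mop (a : Fin 2) (A : Matrix (Fin 2) (Fin 2) ℂ) : Matrix (Fin 2) (Fin 2) ℂ :=
  (1 / 2 : ℂ) • ((1 : Matrix (Fin 2) (Fin 2) ℂ) + (-1 : ℂ) ^ (a : ℕ) • A)

/-- Partial transpose on the second tensor factor:
(τ^{T_B})_{(i,j),(k,l)} = τ_{(i,l),(k,j)}. -/
def partialTransposeB (M : Matrix (Fin 2 × Fin 2) (Fin 2 × Fin 2) ℂ) :
    Matrix (Fin 2 × Fin 2) (Fin 2 × Fin 2) ℂ :=
  fun p q => M (p.1, q.2) (q.1, p.2)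

theorem inv_sqrt_two_mul_self : (Real.sqrt 2 : ℂ)⁻¹ * (Real.sqrt 2 : ℂ)⁻¹ = 1 / 2 := by
  rw [← mul_inv, ← Complex.ofReal_mul, Real.mul_self_sqrt zero_le_two]
  norm_num

/-- Bell projectors are positive semidefinite. -/
theorem bellProj_posSemidef (a b : Fin 2) : (bellProj a b).PosSemidef :=
  posSemidef_vecMulVec_self_star (bellVec a b)

/-- The spectral decomposition of the partial transpose in the Bell basis. -/
theorem partialTransposeB_bellDiag_eq_sum (c₁ c₂ c₃ : ℝ) :
    partialTransposeB (bellDiag c₁ c₂ c₃) =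
      ∑ a : Fin 2, ∑ b : Fin 2,
        ((1 / 2 - lamBD c₁ c₂ c₃ (a + 1) (b + 1) : ℝ) : ℂ) • bellProj a b := by
  ext ⟨i, j⟩ ⟨k, l⟩
  fin_cases i <;> fin_cases j <;> fin_cases k <;> fin_cases l <;>
    simp [partialTransposeB, bellDiag, pauli, bellProj, bellVec, lamBD, vecMulVec_apply,
      div_eq_mul_inv, inv_sqrt_two_mul_self] <;>
    ring

/-- The Bell vectors are orthonormal. -/
theorem star_bellVec_dotProduct_bellVec (a b a' b' : Fin 2) :
    star (bellVec a b) ⬝ᵥ bellVec a' b' = if a = a' ∧ b = b' then 1 else 0 := by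
  fin_cases a <;> fin_cases b <;> fin_cases a' <;> fin_cases b' <;>
    simp [dotProduct, Fintype.sum_prod_type, bellVec, div_eq_mul_inv, inv_sqrt_two_mul_self] <;> norm_num

/-- The expectation of the partial transpose in a Bell state. -/
theorem star_bellVec_dotProduct_partialTransposeB_bellDiag_mulVec (c₁ c₂ c₃ : ℝ) (a b : Fin 2) :
    star (bellVec a b) ⬝ᵥ (partialTransposeB (bellDiag c₁ c₂ c₃) *ᵥ bellVec a b) =
      ((1 / 2 - lamBD c₁ c₂ c₃ (a + 1) (b + 1) : ℝ) : ℂ) := by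
  rw [partialTransposeB_bellDiag_eq_sum]
  simp only [sum_mulVec, smul_mulVec, bellProj, vecMulVec_mulVec, dotProduct_sum,
    dotProduct_smul, star_bellVec_dotProduct_bellVec]
  fin_cases a <;> fin_cases b <;> simp

/-- The partial transpose of the Bell-diagonal matrix is positive semidefinite
iff λ_ab ≤ 1/2 for all a, b. -/
theorem bellDiag_partialTranspose_posSemidef_iff (c₁ c₂ c₃ : ℝ) :
    (partialTransposeB (bellDiag c₁ c₂ c₃)).PosSemidef ↔
      (∀ a b : Fin 2, lamBD c₁ c₂ c₃ a b ≤ 1 / 2) := by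
  constructor
  · intro h a b
    have key := h.dotProduct_mulVec_nonneg (bellVec (a + 1) (b + 1))
    rw [star_bellVec_dotProduct_partialTransposeB_bellDiag_mulVec, Complex.zero_le_real] at key
    have shift : ∀ x : Fin 2, x + 1 + 1 = x := by decide
    rw [shift, shift] at key
    linarith
  · intro h
    rw [partialTransposeB_bellDiag_eq_sum]
    refine posSemidef_sum _ fun a _ => posSemidef_sum _ fun b _ => ?_
    exact (bellProj_posSemidef a b).smul (Complex.zero_le_real.mpr (sub_nonneg.mpr (h _ _)))
end

section
/- Let c₁, c₂, c₃ be real numbers with c₁ ≥ c₂ ≥ |c₃|, c₁ ≥ 0, c₂ ≥ 0, and c₁ + c₂ + c₃ ≤ 1. Then the Bell-diagonal matrix τ admits the decomposition τ = c₂ β₀₁ + 2(λ₀₀ − λ₁₀)·(β₀₀ + β₀₁)/2 + 2λ₁₀·(β₀₀ + β₁₀)/2 + 2λ₁₁·(β₀₁ + β₁₁)/2, where all the coefficients c₂, 2(λ₀₀ − λ₁₀), 2λ₁₀, 2λ₁₁ are nonnegative and sum to 1. (This exhibits τ as a convex mixture of the entangled projector β₀₁ with weight c₂ and a separable state with weight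 1 − c₂.) -/
open Matrix
open scoped Matrix Kronecker

/-- The entries of a Bell projector, with the normalization `1 / √2` squared to `1 / 2`. -/
theorem bellProj_apply (a b : Fin 2) (p q : Fin 2 × Fin 2) :
    bellProj a b p q =
      ((if p = (0, b) then 1 else 0) + (-1 : ℂ) ^ (a : ℕ) * (if p = (1, b + 1) then 1 else 0))
        * ((if q = (0, b) then 1 else 0)
          + (-1 : ℂ) ^ (a : ℕ) * (if q = (1, b + 1) then 1 else 0)) / 2 := by
  have hsqrt : (Real.sqrt 2 : ℂ) * (Real.sqrt 2 : ℂ) = 2 := by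
    rw [← Complex.ofReal_mul, Real.mul_self_sqrt zero_le_two, Complex.ofReal_ofNat]
  simp only [bellProj, vecMulVec_apply, bellVec, Pi.star_apply, star_div₀, star_add, star_mul',
    star_pow, star_neg, star_one, apply_ite star, star_zero, Complex.star_def,
    Complex.conj_ofReal]
  rw [div_mul_div_comm, hsqrt]

/-- The spectral decomposition of a Bell-diagonal matrix. -/
theorem bellDiag_eq_sum_lamBD_smul_bellProj (c₁ c₂ c₃ : ℝ) :
    bellDiag c₁ c₂ c₃ = ∑ a, ∑ b, (lamBD c₁ c₂ c₃ a b : ℂ) • bellProj a b := by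
  ext ⟨i, j⟩ ⟨k, l⟩
  fin_cases i <;> fin_cases j <;> fin_cases k <;> fin_cases l <;>
    simp [bellDiag, bellProj_apply, lamBD, pauli, Fin.sum_univ_two] <;> ring

/-- Decomposition of a Bell-diagonal state (with c₁ ≥ c₂ ≥ |c₃|, c₁,c₂ ≥ 0,
c₁+c₂+c₃ ≤ 1) as a convex mixture of the entangled projector β₀₁ with weight c₂
and separable pieces; the weights are nonnegative and sum to 1. -/
theorem bellDiag_two_setting_decomposition (c₁ c₂ c₃ : ℝ)
    (h12 : c₁ ≥ c₂) (h23 : c₂ ≥ |c₃|) (h1 : c₁ ≥ 0) (h2 : c₂ ≥ 0)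
    (hpos : c₁ + c₂ + c₃ ≤ 1) :
    (bellDiag c₁ c₂ c₃
      = (c₂ : ℂ) • bellProj 0 1
        + ((2 * (lamBD c₁ c₂ c₃ 0 0 - lamBD c₁ c₂ c₃ 1 0) : ℝ) : ℂ) •
            ((1 / 2 : ℂ) • (bellProj 0 0 + bellProj 0 1))
        + ((2 * lamBD c₁ c₂ c₃ 1 0 : ℝ) : ℂ) •
            ((1 / 2 : ℂ) • (bellProj 0 0 + bellProj 1 0))
        + ((2 * lamBD c₁ c₂ c₃ 1 1 : ℝ) : ℂ) •
            ((1 / 2 : ℂ) • (bellProj 0 1 + bellProj 1 1))) ∧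
    0 ≤ c₂ ∧
    0 ≤ 2 * (lamBD c₁ c₂ c₃ 0 0 - lamBD c₁ c₂ c₃ 1 0) ∧
    0 ≤ 2 * lamBD c₁ c₂ c₃ 1 0 ∧
    0 ≤ 2 * lamBD c₁ c₂ c₃ 1 1 ∧
    c₂ + 2 * (lamBD c₁ c₂ c₃ 0 0 - lamBD c₁ c₂ c₃ 1 0)
      + 2 * lamBD c₁ c₂ c₃ 1 0 + 2 * lamBD c₁ c₂ c₃ 1 1 = 1 := by
  have h00 : lamBD c₁ c₂ c₃ 0 0 = (1 + c₁ - c₂ + c₃) / 4 := by simp [lamBD]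
  have h01 : lamBD c₁ c₂ c₃ 0 1 = (1 + c₁ + c₂ - c₃) / 4 := by simp [lamBD]; ring
  have h10 : lamBD c₁ c₂ c₃ 1 0 = (1 - c₁ + c₂ + c₃) / 4 := by simp [lamBD]; ring
  have h11 : lamBD c₁ c₂ c₃ 1 1 = (1 - c₁ - c₂ - c₃) / 4 := by simp [lamBD]; ring
  have hc₃ : -c₂ ≤ c₃ := (abs_le.mp h23).1
  refine ⟨?_, h2, ?_, ?_, ?_, ?_⟩
  · rw [bellDiag_eq_sum_lamBD_smul_bellProj]
    simp only [Fin.sum_univ_two, h00, h01, h10, h11]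
    push_cast
    module
  all_goals linarith
end

section
/- Let c₁ ≥ c₂ > 0 and define the two-setting box P(a,b|x,y) for a,b,x,y ∈ {0,1} by P(a,b|0,0) = (1 + (−1)^{a+b} c₁)/4, P(a,b|1,1) = (1 + (−1)^{a+b} c₂)/4, and P(a,b|x,y) = 1/4 when x ≠ y. Then for any finite index set Λ with at most 2 elements, there do not exist weights p : Λ → ℝ with p(λ) ≥ 0 and Σ_λ p(λ) = 1, together with conditional distributions q(a|x,λ) ∈ [0,1] (with q(0|x,λ) + q(1|x,λ) = 1 for all x, λ) and r(b|y,λ) ∈ [0,1] (with r(0|y,λ) + r(1|y,λ) = 1 for all y, λ), such that P(a,b|x,y) = Σ_{λ∈Λ} p(λ) q(a|x,λ) r(b|y,λ) for all a,b,x,y. That is, any local hidden-variable simulation of this box requires a hidden variable of dimension strictly greater than 2. -/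
/-- The two-setting box with correlations c₁ (setting pair (0,0)) and c₂
(setting pair (1,1)), and white noise on mismatched settings. -/
noncomputable def box2 (c₁ c₂ : ℝ) (a b x y : Fin 2) : ℝ :=
  if x = y then (1 + (-1 : ℝ) ^ ((a : ℕ) + (b : ℕ)) * (if x = 0 then c₁ else c₂)) / 4
  else 1 / 4

/-- Only products of matrices through an index type with at least `n` elements can be
diagonal of size `n` with nonzero diagonal entries. -/
theorem Matrix.le_card_of_mul_eq_diagonal {n : ℕ} {Λ : Type*} [Fintype Λ]
    {U : Matrix (Fin n) Λ ℝ} {V : Matrix Λ (Fin n) ℝ} {d : Fin n → ℝ} (hd : ∀ i, d i ≠ 0)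
    (h : U * V = Matrix.diagonal d) : n ≤ Fintype.card Λ := by
  have hu : IsUnit (Matrix.diagonal d) := by
    rw [Matrix.isUnit_iff_isUnit_det, Matrix.det_diagonal, isUnit_iff_ne_zero]
    exact Finset.prod_ne_zero_iff.mpr fun i _ => hd i
  have hr := Matrix.rank_of_isUnit _ hu
  rw [← h, Fintype.card_fin] at hr
  calc n = (U * V).rank := hr.symm
    _ ≤ U.rank := Matrix.rank_mul_le_left U V
    _ ≤ Fintype.card Λ := Matrix.rank_le_card_width U

/-- For c₁ ≥ c₂ > 0, the box `box2 c₁ c₂` admits no local hidden-variable model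
with a hidden variable of dimension at most 2. -/
theorem box2_no_dim_two_LHV (c₁ c₂ : ℝ) (h12 : c₁ ≥ c₂) (h2 : c₂ > 0)
    (Λ : Type) [Fintype Λ] (hcard : Fintype.card Λ ≤ 2) :
    ¬ ∃ (p : Λ → ℝ) (q r : Fin 2 → Fin 2 → Λ → ℝ),
      (∀ l, 0 ≤ p l) ∧ (∑ l : Λ, p l = 1) ∧
      (∀ a x l, 0 ≤ q a x l) ∧ (∀ a x l, q a x l ≤ 1) ∧
      (∀ x l, q 0 x l + q 1 x l = 1) ∧
      (∀ b y l, 0 ≤ r b y l) ∧ (∀ b y l, r b y l ≤ 1) ∧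
      (∀ y l, r 0 y l + r 1 y l = 1) ∧
      (∀ a b x y : Fin 2, box2 c₁ c₂ a b x y = ∑ l : Λ, p l * q a x l * r b y l) := by
  rintro ⟨p, q, r, -, -, -, -, -, -, -, -, hbox⟩
  have key (s t : ℝ) (x y : Fin 2) :
      ∑ l, p l * (q 0 x l + s * q 1 x l) * (r 0 y l + t * r 1 y l) =
        box2 c₁ c₂ 0 0 x y + t * box2 c₁ c₂ 0 1 x y + s * box2 c₁ c₂ 1 0 x y
          + s * t * box2 c₁ c₂ 1 1 x y := by
    simp only [hbox, Finset.mul_sum, ← Finset.sum_add_distrib]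
    exact Finset.sum_congr rfl fun l _ => by ring
  let sign : Fin 3 → ℝ := ![1, -1, -1]
  let setting : Fin 3 → Fin 2 := ![0, 0, 1]
  have h3 : 3 ≤ Fintype.card Λ := by
    refine Matrix.le_card_of_mul_eq_diagonal
      (U := Matrix.of fun i l => p l * (q 0 (setting i) l + sign i * q 1 (setting i) l))
      (V := Matrix.of fun l j => r 0 (setting j) l + sign j * r 1 (setting j) l)
      (d := ![1, c₁, c₂]) ?_ ?_
    · intro i
      fin_cases i
      · simp
      · simpa using (h2.trans_le h12).ne'
      · simpa using h2.ne'
    · ext i j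
      simp only [Matrix.mul_apply, Matrix.of_apply, key]
      fin_cases i <;> fin_cases j <;> simp [sign, setting, box2] <;> ring
  omega
end

section
/- Let c₁, c₂, c₃ be real numbers with 0 ≤ c₂ ≤ c₁ ≤ 1 and c₂ < 1, and define the 4×4 matrix ρ_sep = (1/(1−c₂)) [ 2(λ₀₀ − λ₁₀)·(β₀₀ + β₀₁)/2 + 2λ₁₀·(β₀₀ + β₁₀)/2 + 2λ₁₁·(β₀₁ + β₁₁)/2 ]. Consider the two-setting box generated by measuring A₀ = B₀ = σ₁ and A₁ = B₁ = σ₂ on ρ_sep, i.e., P(a,b|x,y) := Tr[(M_a(A_x) ⊗ M_b(B_y)) ρ_sep] for a,b,x,y ∈ {0,1}. Then this box admits a local hidden variable–local hidden state model of dimension 2: there exist conditional distributions q(a|x,λ) ∈ [0,1] with q(0|x,λ) + q(1|x,λ) = 1, and 2×2 positive semidefinite matrices ρ₀, ρ₁ of unit trace, such that P(a,b|x,y) = Σ_{λ∈{0,1}} (1/2) q(a|x,λ) Tr[M_b(B_y) ρ_λ] for all a,b,x,y. -/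
open Matrix
open scoped Matrix Kronecker ComplexOrder

/-- The separable state ρ_sep appearing in the two-setting decomposition of the
Bell-diagonal state. -/
noncomputable def rhoSepTwo (c₁ c₂ c₃ : ℝ) : Matrix (Fin 2 × Fin 2) (Fin 2 × Fin 2) ℂ :=
  (((1 - c₂ : ℝ) : ℂ))⁻¹ •
    (((2 * (lamBD c₁ c₂ c₃ 0 0 - lamBD c₁ c₂ c₃ 1 0) : ℝ) : ℂ) •
        ((1 / 2 : ℂ) • (bellProj 0 0 + bellProj 0 1))
      + ((2 * lamBD c₁ c₂ c₃ 1 0 : ℝ) : ℂ) •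
        ((1 / 2 : ℂ) • (bellProj 0 0 + bellProj 1 0))
      + ((2 * lamBD c₁ c₂ c₃ 1 1 : ℝ) : ℂ) •
        ((1 / 2 : ℂ) • (bellProj 0 1 + bellProj 1 1)))

lemma ofReal_sqrt_two_mul_self : (Real.sqrt 2 : ℂ) * (Real.sqrt 2 : ℂ) = 2 := by
  rw [← Complex.ofReal_mul, Real.mul_self_sqrt (by norm_num)]
  norm_num

/-- The equal mixture of `β₀₀` and `β₀₁` has only a `σ₁ ⊗ σ₁` correlation. -/
lemma bellProj_zero_zero_add_zero_one :
    bellProj 0 0 + bellProj 0 1 = (1 / 2 : ℂ) •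
      ((1 : Matrix (Fin 2) (Fin 2) ℂ) ⊗ₖ (1 : Matrix (Fin 2) (Fin 2) ℂ)
        + pauli 0 ⊗ₖ pauli 0) := by
  ext ⟨i, j⟩ ⟨k, l⟩
  fin_cases i <;> fin_cases j <;> fin_cases k <;> fin_cases l <;>
    simp [bellProj, bellVec, pauli, vecMulVec_apply, ← mul_inv, ofReal_sqrt_two_mul_self]

/-- The equal mixture of `β₀₀` and `β₁₀` has only a `σ₃ ⊗ σ₃` correlation. -/
lemma bellProj_zero_zero_add_one_zero :
    bellProj 0 0 + bellProj 1 0 = (1 / 2 : ℂ) •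
      ((1 : Matrix (Fin 2) (Fin 2) ℂ) ⊗ₖ (1 : Matrix (Fin 2) (Fin 2) ℂ)
        + pauli 2 ⊗ₖ pauli 2) := by
  ext ⟨i, j⟩ ⟨k, l⟩
  fin_cases i <;> fin_cases j <;> fin_cases k <;> fin_cases l <;>
    simp [bellProj, bellVec, pauli, vecMulVec_apply, ← mul_inv, div_eq_mul_inv,
      ofReal_sqrt_two_mul_self] <;> norm_num

/-- The equal mixture of `β₀₁` and `β₁₁` has only a `σ₃ ⊗ σ₃` anticorrelation. -/
lemma bellProj_zero_one_add_one_one :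
    bellProj 0 1 + bellProj 1 1 = (1 / 2 : ℂ) •
      ((1 : Matrix (Fin 2) (Fin 2) ℂ) ⊗ₖ (1 : Matrix (Fin 2) (Fin 2) ℂ)
        - pauli 2 ⊗ₖ pauli 2) := by
  ext ⟨i, j⟩ ⟨k, l⟩
  fin_cases i <;> fin_cases j <;> fin_cases k <;> fin_cases l <;>
    simp [bellProj, bellVec, pauli, vecMulVec_apply, ← mul_inv, div_eq_mul_inv,
      ofReal_sqrt_two_mul_self] <;> norm_num

/-- Expectation of a product observable in `rhoSepTwo`, when the first factor has no `σ₃`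
component. -/
lemma trace_kronecker_mul_rhoSepTwo {c₁ c₂ : ℝ} (c₃ : ℝ) (hne : c₂ < 1)
    (A B : Matrix (Fin 2) (Fin 2) ℂ) (hA : (A * pauli 2).trace = 0) :
    ((A ⊗ₖ B) * rhoSepTwo c₁ c₂ c₃).trace =
      (1 / 4 : ℂ) * (A.trace * B.trace + (((c₁ - c₂) / (1 - c₂) : ℝ) : ℂ) *
        ((A * pauli 0).trace * (B * pauli 0).trace)) := by
  have hc : (1 - c₂ : ℂ) ≠ 0 := by
    exact_mod_cast (sub_pos.mpr hne).ne'
  simp only [rhoSepTwo, bellProj_zero_zero_add_zero_one, bellProj_zero_zero_add_one_zero,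
    bellProj_zero_one_add_one_one, Matrix.mul_smul, Matrix.mul_add, Matrix.mul_sub, trace_smul,
    trace_add, trace_sub, ← mul_kronecker_mul, trace_kronecker, hA, Matrix.mul_one, smul_eq_mul,
    lamBD]
  push_cast
  field_simp
  simp
  ring

/-- A qubit state with Bloch vector along the first axis is positive semidefinite. -/
lemma posSemidef_bloch_one {r : ℝ} (h₁ : -1 ≤ r) (h₂ : r ≤ 1) :
    ((1 / 2 : ℂ) • ((1 : Matrix (Fin 2) (Fin 2) ℂ) + (r : ℂ) • pauli 0)).PosSemidef := by
  have key : (1 / 2 : ℂ) • ((1 : Matrix (Fin 2) (Fin 2) ℂ) + (r : ℂ) • pauli 0) =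
      (((1 + r) / 4 : ℝ) : ℂ) • vecMulVec ![1, 1] (star ![1, 1]) +
      (((1 - r) / 4 : ℝ) : ℂ) • vecMulVec ![1, -1] (star ![1, -1]) := by
    ext i j
    simp only [Matrix.add_apply, Matrix.smul_apply, vecMulVec_apply, Pi.star_apply]
    fin_cases i <;> fin_cases j <;> simp [pauli] <;> ring
  rw [key]
  refine ((posSemidef_vecMulVec_self_star _).smul ?_).add
    ((posSemidef_vecMulVec_self_star _).smul ?_)
  · exact Complex.zero_le_real.mpr (by linarith)
  · exact Complex.zero_le_real.mpr (by linarith)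

/-- The box produced by measuring A₀ = B₀ = σ₁ and A₁ = B₁ = σ₂ on ρ_sep admits a
local hidden variable–local hidden state model of dimension 2 with uniform weights. -/
theorem rhoSepTwo_LHV_LHS_dim_two (c₁ c₂ c₃ : ℝ)
    (h0 : 0 ≤ c₂) (h21 : c₂ ≤ c₁) (h1 : c₁ ≤ 1) (hne : c₂ < 1) :
    ∃ (q : Fin 2 → Fin 2 → Fin 2 → ℝ) (ρ : Fin 2 → Matrix (Fin 2) (Fin 2) ℂ),
      (∀ a x l, 0 ≤ q a x l) ∧ (∀ a x l, q a x l ≤ 1) ∧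
      (∀ x l, q 0 x l + q 1 x l = 1) ∧
      (∀ l, (ρ l).PosSemidef) ∧ (∀ l, (ρ l).trace = 1) ∧
      (∀ a b x y : Fin 2,
        ((Mop a (![pauli 0, pauli 1] x) ⊗ₖ Mop b (![pauli 0, pauli 1] y))
            * rhoSepTwo c₁ c₂ c₃).trace
          = ∑ l : Fin 2,
              ((1 / 2 : ℝ) * q a x l : ℝ) * (Mop b (![pauli 0, pauli 1] y) * ρ l).trace) := by
  have hpos : 0 < 1 - c₂ := sub_pos.mpr hne
  set t : ℝ := (c₁ - c₂) / (1 - c₂) with ht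
  have ht0 : 0 ≤ t := div_nonneg (sub_nonneg.mpr h21) hpos.le
  have ht1 : t ≤ 1 := (div_le_one hpos).mpr (by linarith)
  refine ⟨fun a x l => if x = 0 then (if a = l then 1 else 0) else 1 / 2,
    fun l => (1 / 2 : ℂ) • ((1 : Matrix (Fin 2) (Fin 2) ℂ) +
      (((-1) ^ (l : ℕ) * t : ℝ) : ℂ) • pauli 0), ?_, ?_, ?_, ?_, ?_, ?_⟩
  · intro a x l
    dsimp only
    split_ifs <;> norm_num
  · intro a x l
    dsimp only
    split_ifs <;> norm_num
  · intro x l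
    fin_cases x <;> fin_cases l <;> norm_num
  · intro l
    apply posSemidef_bloch_one <;> fin_cases l <;> simp <;> linarith
  · intro l
    simp [pauli, trace_fin_two]
  · intro a b x y
    rw [trace_kronecker_mul_rhoSepTwo c₃ hne _ _ (by
      fin_cases x <;> simp [Mop, pauli, trace_fin_two, Matrix.mul_apply]), ← ht]
    fin_cases a <;> fin_cases b <;> fin_cases x <;> fin_cases y <;>
      simp [Mop, pauli, trace_fin_two, Matrix.mul_apply] <;> ring
end

section
/- Let c₁ ≥ c₂ > 0 be real numbers with c₁ + c₂ ≤ 1. Then 1/√(c₁^(−2) + c₂^(−2)) ≤ 1/(2√2), with equality if and only if c₁ = c₂ = 1/2. Consequently, the worst-case success probability of the 2→1 quantum random access code assisted by such a Bell-diagonal state, P_min = (1/2)(1 + 1/√(c₁^(−2) + c₂^(−2))), is at most (1/2)(1 + 1/(2√2)) ≈ 0.677, which strictly exceeds the classical bound 2/3. -/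
/-- The tangent line of `c ↦ c⁻¹` at `1 / 2` lies below its graph. -/
lemma four_sub_four_mul_le_inv {c : ℝ} (hc : 0 < c) : 4 - 4 * c ≤ c⁻¹ := by
  rw [← one_div, le_div_iff₀ hc]
  nlinarith [sq_nonneg (2 * c - 1)]

lemma eight_le_inv_sq_add_inv_sq {a b : ℝ} (ha : 0 < a) (hb : 0 < b) (hab : a + b ≤ 1) :
    8 ≤ a⁻¹ ^ 2 + b⁻¹ ^ 2 := by
  nlinarith [four_sub_four_mul_le_inv ha, four_sub_four_mul_le_inv hb,
    sq_nonneg (a⁻¹ - 2), sq_nonneg (b⁻¹ - 2)]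

lemma inv_sq_add_inv_sq_eq_eight_iff {a b : ℝ} (ha : 0 < a) (hb : 0 < b) (hab : a + b ≤ 1) :
    a⁻¹ ^ 2 + b⁻¹ ^ 2 = 8 ↔ a = 1 / 2 ∧ b = 1 / 2 := by
  refine ⟨fun h => ?_, ?_⟩
  · have h₁ := four_sub_four_mul_le_inv ha
    have h₂ := four_sub_four_mul_le_inv hb
    have ha' : a⁻¹ - 2 = 0 := by
      apply pow_eq_zero_iff two_ne_zero |>.mp
      nlinarith [sq_nonneg (a⁻¹ - 2), sq_nonneg (b⁻¹ - 2)]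
    have hb' : b⁻¹ - 2 = 0 := by
      apply pow_eq_zero_iff two_ne_zero |>.mp
      nlinarith [sq_nonneg (a⁻¹ - 2), sq_nonneg (b⁻¹ - 2)]
    constructor
    · rw [← inv_inv a, sub_eq_zero.mp ha', one_div]
    · rw [← inv_inv b, sub_eq_zero.mp hb', one_div]
  · rintro ⟨rfl, rfl⟩
    norm_num

lemma two_mul_sqrt_two_eq_sqrt_eight : 2 * Real.sqrt 2 = Real.sqrt 8 := by
  rw [show (8 : ℝ) = 2 ^ 2 * 2 by norm_num, Real.sqrt_mul (by norm_num),
    Real.sqrt_sq (by norm_num)]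

/-- For separable Bell-diagonal correlation coefficients c₁ ≥ c₂ > 0 with
c₁ + c₂ ≤ 1, the quantity 1/√(c₁⁻² + c₂⁻²) is at most 1/(2√2), with equality iff
c₁ = c₂ = 1/2; hence the 2→1 RAC efficiency P_min = (1/2)(1 + 1/√(c₁⁻²+c₂⁻²)) is
at most (1/2)(1 + 1/(2√2)), which strictly exceeds the classical bound 2/3. -/
theorem rac_two_to_one_efficiency_bound (c₁ c₂ : ℝ)
    (h12 : c₁ ≥ c₂) (h2 : c₂ > 0) (hsep : c₁ + c₂ ≤ 1) :
    (1 / Real.sqrt (c₁⁻¹ ^ 2 + c₂⁻¹ ^ 2) ≤ 1 / (2 * Real.sqrt 2)) ∧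
    (1 / Real.sqrt (c₁⁻¹ ^ 2 + c₂⁻¹ ^ 2) = 1 / (2 * Real.sqrt 2)
      ↔ c₁ = 1 / 2 ∧ c₂ = 1 / 2) ∧
    (1 / 2 * (1 + 1 / Real.sqrt (c₁⁻¹ ^ 2 + c₂⁻¹ ^ 2))
      ≤ 1 / 2 * (1 + 1 / (2 * Real.sqrt 2))) ∧
    ((2 : ℝ) / 3 < 1 / 2 * (1 + 1 / (2 * Real.sqrt 2))) := by
  have h1 : 0 < c₁ := h2.trans_le h12
  have h8 := eight_le_inv_sq_add_inv_sq h1 h2 hsep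
  have hle : 1 / Real.sqrt (c₁⁻¹ ^ 2 + c₂⁻¹ ^ 2) ≤ 1 / (2 * Real.sqrt 2) := by
    rw [two_mul_sqrt_two_eq_sqrt_eight]
    gcongr
  refine ⟨hle, ?_, by linarith, ?_⟩
  · rw [← inv_sq_add_inv_sq_eq_eight_iff h1 h2 hsep, two_mul_sqrt_two_eq_sqrt_eight,
      one_div, one_div, inv_inj, Real.sqrt_inj (by linarith) (by norm_num)]
  · have hlt : Real.sqrt 2 < 3 / 2 := by
      rw [Real.sqrt_lt' (by norm_num)]
      norm_num
    have : (1 : ℝ) / 3 < 1 / (2 * Real.sqrt 2) :=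
      one_div_lt_one_div_of_lt (by positivity) (by linarith)
    linarith
end

section
/- Let t₁, t₂, t₃ > 0 be real numbers with t₁ + t₂ + t₃ ≤ 1. Then 1/√(t₁^(−2) + t₂^(−2) + t₃^(−2)) ≤ 1/(3√3), with equality if and only if t₁ = t₂ = t₃ = 1/3. Consequently, the worst-case success probability of the 3→1 quantum random access code assisted by a Bell-diagonal state with |cᵢ| = tᵢ, P_min = (1/2)(1 + 1/√(t₁^(−2) + t₂^(−2) + t₃^(−2))), is at most (1/2)(1 + 1/(3√3)) ≈ 0.596, which strictly exceeds the classical bound 1/2. -/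
/-- The convex function `t ↦ t⁻²` minus its tangent line at `t = 1 / 3`, in factored form. -/
theorem inv_sq_sub_tangent_at_third {t : ℝ} (ht : t ≠ 0) :
    t⁻¹ ^ 2 - (27 - 54 * t) = (3 * t - 1) ^ 2 * ((6 * t + 1) * t⁻¹ ^ 2) := by
  field_simp
  ring

theorem tangent_at_third_le_inv_sq {t : ℝ} (ht : 0 < t) : 27 - 54 * t ≤ t⁻¹ ^ 2 := by
  have h := inv_sq_sub_tangent_at_third ht.ne'
  have : 0 ≤ (3 * t - 1) ^ 2 * ((6 * t + 1) * t⁻¹ ^ 2) := by positivity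
  linarith

theorem eq_third_of_inv_sq_le_tangent {t : ℝ} (ht : 0 < t) (hle : t⁻¹ ^ 2 ≤ 27 - 54 * t) :
    t = 1 / 3 := by
  have h := inv_sq_sub_tangent_at_third ht.ne'
  have hpos : 0 < (6 * t + 1) * t⁻¹ ^ 2 := by positivity
  have hsq : (3 * t - 1) ^ 2 = 0 :=
    le_antisymm (nonpos_of_mul_nonpos_left (by linarith) hpos) (sq_nonneg _)
  have := pow_eq_zero_iff two_ne_zero |>.mp hsq
  linarith


/-- For t₁, t₂, t₃ > 0 with t₁ + t₂ + t₃ ≤ 1, the quantity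
1/√(t₁⁻² + t₂⁻² + t₃⁻²) is at most 1/(3√3), with equality iff
t₁ = t₂ = t₃ = 1/3; hence the 3→1 RAC efficiency
P_min = (1/2)(1 + 1/√(t₁⁻²+t₂⁻²+t₃⁻²)) is at most (1/2)(1 + 1/(3√3)),
which strictly exceeds the classical bound 1/2. -/
theorem rac_three_to_one_efficiency_bound (t₁ t₂ t₃ : ℝ)
    (h1 : 0 < t₁) (h2 : 0 < t₂) (h3 : 0 < t₃) (hsep : t₁ + t₂ + t₃ ≤ 1) :
    (1 / Real.sqrt (t₁⁻¹ ^ 2 + t₂⁻¹ ^ 2 + t₃⁻¹ ^ 2) ≤ 1 / (3 * Real.sqrt 3)) ∧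
    (1 / Real.sqrt (t₁⁻¹ ^ 2 + t₂⁻¹ ^ 2 + t₃⁻¹ ^ 2) = 1 / (3 * Real.sqrt 3)
      ↔ t₁ = 1 / 3 ∧ t₂ = 1 / 3 ∧ t₃ = 1 / 3) ∧
    (1 / 2 * (1 + 1 / Real.sqrt (t₁⁻¹ ^ 2 + t₂⁻¹ ^ 2 + t₃⁻¹ ^ 2))
      ≤ 1 / 2 * (1 + 1 / (3 * Real.sqrt 3))) ∧
    ((1 : ℝ) / 2 < 1 / 2 * (1 + 1 / (3 * Real.sqrt 3))) := by
  have e1 := tangent_at_third_le_inv_sq h1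
  have e2 := tangent_at_third_le_inv_sq h2
  have e3 := tangent_at_third_le_inv_sq h3
  have hsqrt : 3 * Real.sqrt 3 = Real.sqrt 27 := by
    rw [show (27 : ℝ) = 3 ^ 2 * 3 by norm_num, Real.sqrt_mul (by positivity),
      Real.sqrt_sq (by norm_num)]
  have hmain : 1 / Real.sqrt (t₁⁻¹ ^ 2 + t₂⁻¹ ^ 2 + t₃⁻¹ ^ 2) ≤ 1 / (3 * Real.sqrt 3) := by
    rw [hsqrt]
    exact one_div_le_one_div_of_le (by positivity) (Real.sqrt_le_sqrt (by linarith))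
  refine ⟨hmain, ⟨fun h => ?_, ?_⟩, by linarith, ?_⟩
  · rw [hsqrt, one_div, one_div, inv_inj,
      Real.sqrt_inj (by positivity) (by norm_num)] at h
    exact ⟨eq_third_of_inv_sq_le_tangent h1 (by linarith),
      eq_third_of_inv_sq_le_tangent h2 (by linarith),
      eq_third_of_inv_sq_le_tangent h3 (by linarith)⟩
  · rintro ⟨rfl, rfl, rfl⟩
    rw [hsqrt]
    norm_num
  · have : 0 < 1 / (3 * Real.sqrt 3) := by positivity
    linarith
end
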